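/- Let (PA_t)_{t≥1} be a preferential attachment model with m ≥ 2 and δ ∈ (−m, 0). Fix ε > 0 and set k_t^− = (1−ε) log log t/log m. Then the expected number M_{k_t^−} of minimally-k_t^−-connected vertices satisfies E[M_{k_t^−}] → ∞ as t → ∞. -/

import Mathlib

open Finset Filter

open scoped Classical

noncomputable section

/-- A realization of the attachment choices of the preferential attachment model of
size `t` with `m` edges per vertex: `ξ s j` is the vertex (0-based; vertex `v : Fin t`
represents the 1-based vertex `v.val + 1 ∈ [t]`) to which the `(j+1)`-st edge of
vertex `s.val + 1` is attached. -/
abbrev PAConfig (t m : ℕ) : Type := Fin t → Fin m → Fin t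

/-- The degree `D_{s,j}(v)` of the 1-based vertex `v` after the first `j` edges of the
1-based vertex `s` have been attached (a self-loop contributes 2 to the degree). -/
def paDeg {t m : ℕ} (ξ : PAConfig t m) (s j v : ℕ) : ℕ :=
  ∑ ui : Fin t × Fin m,
    if ui.1.val + 1 < s ∨ (ui.1.val + 1 = s ∧ ui.2.val + 1 ≤ j) then
      (if (ξ ui.1 ui.2).val + 1 = v then 1 else 0) + (if ui.1.val + 1 = v then 1 else 0)
    else 0

/-- The normalizing constant `c_{s,j} = [m(s-1)+(j-1)](2+δ/m) + 1 + δ/m`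
(`s`, `j` 1-based). -/
def paC (m : ℕ) (δ : ℝ) (s j : ℕ) : ℝ :=
  ((m : ℝ) * ((s : ℝ) - 1) + ((j : ℝ) - 1)) * (2 + δ / m) + 1 + δ / m

/-- The probability of the realization `ξ` of the preferential attachment model
`PA_t(m, δ)`: the product over all edges of the conditional attachment probabilities
`(D_{s,j-1}(v) + 1 + jδ/m)/c_{s,j}` (self-loop) resp. `(D_{s,j-1}(v) + δ)/c_{s,j}`
(attachment to an older vertex `v < s`). -/
def paWeight (t m : ℕ) (δ : ℝ) (ξ : PAConfig t m) : ℝ :=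
  ∏ s : Fin t, ∏ j : Fin m,
    if (ξ s j).val = s.val then
      ((paDeg ξ (s.val + 1) j.val (s.val + 1) : ℝ) + 1 + ((j.val : ℝ) + 1) * δ / m) /
        paC m δ (s.val + 1) (j.val + 1)
    else if (ξ s j).val < s.val then
      ((paDeg ξ (s.val + 1) j.val ((ξ s j).val + 1) : ℝ) + δ) /
        paC m δ (s.val + 1) (j.val + 1)
    else 0

/-- The probability of an event under the preferential attachment model `PA_t(m, δ)`. -/
def paProb (t m : ℕ) (δ : ℝ) (E : PAConfig t m → Prop) : ℝ :=
  ∑ ξ ∈ (univ : Finset (PAConfig t m)).filter E, paWeight t m δ ξ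

/-- The expectation of a random variable under `PA_t(m, δ)`. -/
def paExp (t m : ℕ) (δ : ℝ) (f : PAConfig t m → ℝ) : ℝ :=
  ∑ ξ : PAConfig t m, paWeight t m δ ξ * f ξ

/-- Adjacency in the graph `PA_t`. -/
def paAdj {t m : ℕ} (ξ : PAConfig t m) (u v : Fin t) : Prop :=
  ∃ j : Fin m, ξ u j = v ∨ ξ v j = u

/-- The degree `D_t(v)` of the vertex `v` at time `t`, i.e. in the graph `PA_t`. -/
def paDegT {t m : ℕ} (ξ : PAConfig t m) (v : Fin t) : ℕ := paDeg ξ t m (v.val + 1)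

/-- There is a walk of length `k` from `u` to `v` in the graph with adjacency relation `A`. -/
def reachIn {V : Type*} (A : V → V → Prop) (u v : V) (k : ℕ) : Prop :=
  ∃ p : ℕ → V, p 0 = u ∧ p k = v ∧ ∀ i < k, A (p i) (p (i + 1))

/-- Graph distance (`⊤` if there is no path). -/
def graphDist {V : Type*} (A : V → V → Prop) (u v : V) : ℕ∞ :=
  ⨅ (k : ℕ) (_ : reachIn A u v k), (k : ℕ∞)

/-- Graph diameter: the maximal graph distance between pairs of vertices. -/
def graphDiam {V : Type*} (A : V → V → Prop) : ℕ∞ :=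
  ⨆ (u : V) (v : V), graphDist A u v

/-- The `k`-neighbourhood `U_{≤k}(v)` of `v` in `PA_t`. -/
def paBallF {t m : ℕ} (ξ : PAConfig t m) (v : Fin t) (k : ℕ) : Finset (Fin t) :=
  univ.filter (fun u => graphDist (paAdj ξ) v u ≤ (k : ℕ∞))

/-- `i_k = 1 + ∑_{i=1}^k m^i = (m^{k+1} - 1)/(m - 1)`, the number of vertices of the
tree of a minimally-`k`-connected vertex. -/
def paik (m k : ℕ) : ℕ := ∑ l ∈ Finset.range (k + 1), m ^ l

/-- `v ∈ [t] \ [t/2]` is minimally-`k`-connected: `D_t(v) = m`, every other vertex of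
`U_{≤k}(v)` lies in `[t/2] \ [t/4]` and has degree `m + 1` at time `t`, and `U_{≤k}(v)`
contains no self-loops, multiple edges or cycles (equivalently, it has exactly `i_k`
vertices and `i_k - 1` internal edges, hence is a tree). -/
def paMinConn {t m : ℕ} (ξ : PAConfig t m) (v : Fin t) (k : ℕ) : Prop :=
  t / 2 ≤ v.val ∧ paDegT ξ v = m ∧
  (∀ u ∈ paBallF ξ v k, u ≠ v → (t / 4 ≤ u.val ∧ u.val < t / 2) ∧ paDegT ξ u = m + 1) ∧
  (paBallF ξ v k).card = paik m k ∧
  ((univ : Finset (Fin t × Fin m)).filter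
      (fun uj => uj.1 ∈ paBallF ξ v k ∧ ξ uj.1 uj.2 ∈ paBallF ξ v k)).card =
    paik m k - 1

/-- `M_k`: the number of minimally-`k`-connected vertices of `PA_t`. -/
def paMk {t m : ℕ} (ξ : PAConfig t m) (k : ℕ) : ℕ :=
  ((univ : Finset (Fin t)).filter (fun v => paMinConn ξ v k)).card

/-- `k_t^- = (1 - ε) log log t / log m`, rounded to the nearest integer. -/
def ktMinus (ε : ℝ) (m t : ℕ) : ℕ :=
  (round ((1 - ε) * Real.log (Real.log t) / Real.log m)).toNat

theorem sum_eq_sum_sum_update {ι α : Type*} [Fintype ι] [DecidableEq ι] [Fintype α]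
    (G : (ι → α) → ℝ) (i : ι) :
    ∑ ξ : ι → α, ∑ x : α, G (Function.update ξ i x) = Fintype.card α * ∑ ξ, G ξ := by
  have h : ∀ x : α, ∑ ξ : ι → α, G (Function.update ξ i x) =
      Fintype.card α * ∑ ξ : ι → α, if ξ i = x then G ξ else 0 := by
    intro x
    have h1 : ∀ ξ : ι → α, G (Function.update ξ i x) =
        ∑ ζ : ι → α, if ζ = Function.update ξ i x then G ζ else 0 := by
      intro ξ; simp
    simp_rw [h1]
    rw [Finset.sum_comm, Finset.mul_sum]
    refine Finset.sum_congr rfl fun ζ _ => ?_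
    by_cases hζ : ζ i = x
    · rw [if_pos hζ, ← Finset.sum_filter, Finset.sum_const, nsmul_eq_mul]
      congr 2
      rw [← Finset.card_univ (α := α)]
      symm
      refine Finset.card_bij (fun y _ => Function.update ζ i y) ?_ ?_ ?_
      · intro y _
        simp [← hζ]
      · intro y _ y' _ h
        simpa using congrFun h i
      · intro ξ hξ
        refine ⟨ξ i, Finset.mem_univ _, ?_⟩
        simp only [Finset.mem_filter, Finset.mem_univ, true_and] at hξ
        rw [hξ]; simp
    · rw [if_neg hζ, mul_zero]
      refine Finset.sum_eq_zero fun ξ _ => if_neg ?_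
      rintro rfl
      exact hζ (by simp)
  rw [Finset.sum_comm]
  simp_rw [h]
  rw [← Finset.mul_sum, Finset.sum_comm]
  simp

/-- Sequential lower bound: if every factor `F i` depends only on the coordinates up to `i`, and
its sum over the `i`-th coordinate is at least `p i` as long as the earlier factors do not vanish,
then the total sum of the product is at least the product of the `p i`. -/
theorem prod_le_sum_prod_of_step {ι α : Type*} [Fintype ι] [LinearOrder ι] [Fintype α] [Nonempty α]
    (F : ι → (ι → α) → ℝ) (p : ι → ℝ) (hF : ∀ i ξ, 0 ≤ F i ξ) (hp : ∀ i, 0 ≤ p i)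
    (hloc : ∀ i ξ ξ', (∀ i' ≤ i, ξ i' = ξ' i') → F i ξ = F i ξ')
    (hstep : ∀ i ξ, (∀ i' < i, F i' ξ ≠ 0) → p i ≤ ∑ x, F i (Function.update ξ i x)) :
    ∏ i, p i ≤ ∑ ξ, ∏ i, F i ξ := by
  have hα : (0 : ℝ) < Fintype.card α := by exact_mod_cast Fintype.card_pos
  have key : ∀ s : Finset ι, IsLowerSet (s : Set ι) →
      (Fintype.card α : ℝ) ^ (Fintype.card ι) * ∏ i ∈ s, p i ≤
        (Fintype.card α : ℝ) ^ s.card * ∑ ξ, ∏ i ∈ s, F i ξ := by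
    intro s
    induction s using Finset.induction_on_max with
    | empty => intro _; simp
    | insert a s ha ih =>
      intro hlow
      have has : a ∉ s := fun h => lt_irrefl _ (ha a h)
      have hlow' : IsLowerSet (s : Set ι) := by
        intro x y hyx hx
        have : y ∈ (↑(insert a s) : Set ι) := hlow hyx (by simpa using Or.inr hx)
        rcases Finset.mem_insert.1 (Finset.mem_coe.1 this) with rfl | h
        · exact absurd (ha x hx) (not_lt.2 hyx)
        · exact h
      have ih := ih hlow'
      have hstep' : p a * ∑ ξ, ∏ i ∈ s, F i ξ ≤
          Fintype.card α * ∑ ξ, ∏ i ∈ insert a s, F i ξ := by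
        rw [← sum_eq_sum_sum_update _ a, Finset.mul_sum]
        refine Finset.sum_le_sum fun ξ _ => ?_
        have h1 : ∀ x, ∏ i ∈ insert a s, F i (Function.update ξ a x) =
            F a (Function.update ξ a x) * ∏ i ∈ s, F i ξ := by
          intro x
          rw [Finset.prod_insert has]
          congr 1
          refine Finset.prod_congr rfl fun i hi => hloc _ _ _ fun i' hi' => ?_
          exact Function.update_of_ne (ne_of_lt (hi'.trans_lt (ha i hi))) _ _
        simp_rw [h1]
        rw [← Finset.sum_mul]
        by_cases h0 : ∏ i ∈ s, F i ξ = 0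
        · simp [h0]
        · refine mul_le_mul_of_nonneg_right (hstep a ξ fun i hi => ?_)
            (Finset.prod_nonneg fun i _ => hF i ξ)
          have : i ∈ (↑(insert a s) : Set ι) := hlow hi.le (by simp)
          rcases Finset.mem_insert.1 (Finset.mem_coe.1 this) with rfl | h
          · exact absurd hi (lt_irrefl _)
          · exact Finset.prod_ne_zero_iff.1 h0 i h
      calc _ = p a * ((Fintype.card α : ℝ) ^ (Fintype.card ι) * ∏ i ∈ s, p i) := by
            rw [Finset.prod_insert has]; ring
        _ ≤ p a * ((Fintype.card α : ℝ) ^ s.card * ∑ ξ, ∏ i ∈ s, F i ξ) :=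
            mul_le_mul_of_nonneg_left ih (hp a)
        _ = (Fintype.card α : ℝ) ^ s.card * (p a * ∑ ξ, ∏ i ∈ s, F i ξ) := by ring
        _ ≤ (Fintype.card α : ℝ) ^ s.card *
            (Fintype.card α * ∑ ξ, ∏ i ∈ insert a s, F i ξ) :=
            mul_le_mul_of_nonneg_left hstep' (by positivity)
        _ = _ := by rw [Finset.card_insert_of_notMem has]; ring
  have h := key Finset.univ (by simpa using isLowerSet_univ)
  rw [Finset.card_univ] at h
  exact le_of_mul_le_mul_left h (by positivity)

/-- Edge `u` is attached strictly before the `j`-th edge (0-based) of vertex `s` (0-based). -/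
def paBefore {t m : ℕ} (u : Fin t × Fin m) (s : Fin t) (j : Fin m) : Prop :=
  u.1 < s ∨ (u.1 = s ∧ u.2 < j)

theorem paDeg_succ_eq {t m : ℕ} (ξ : PAConfig t m) (s : Fin t) (j : Fin m) (x : Fin t) :
    paDeg ξ (s.val + 1) j.val (x.val + 1) =
      ∑ u : Fin t × Fin m, if paBefore u s j then
        (if ξ u.1 u.2 = x then 1 else 0) + (if u.1 = x then 1 else 0) else 0 := by
  unfold paDeg paBefore
  refine Finset.sum_congr rfl fun u _ => ?_
  simp only [Fin.ext_iff, Fin.lt_def, Nat.add_lt_add_iff_right, Nat.add_right_cancel_iff,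
    Nat.succ_le_iff]

theorem paDeg_congr {t m : ℕ} {ξ ξ' : PAConfig t m} {s : Fin t} {j : Fin m}
    (h : ∀ u : Fin t × Fin m, paBefore u s j → ξ u.1 u.2 = ξ' u.1 u.2) (x : Fin t) :
    paDeg ξ (s.val + 1) j.val (x.val + 1) = paDeg ξ' (s.val + 1) j.val (x.val + 1) := by
  rw [paDeg_succ_eq, paDeg_succ_eq]
  refine Finset.sum_congr rfl fun u _ => ?_
  by_cases h1 : paBefore u s j
  · rw [h u h1]
  · simp only [if_neg h1]

theorem card_filter_fst_eq {t m : ℕ} (x : Fin t) :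
    ((univ : Finset (Fin t × Fin m)).filter (fun u => u.1 = x)).card = m := by
  have : (univ : Finset (Fin t × Fin m)).filter (fun u => u.1 = x) = {x} ×ˢ univ := by
    ext u; simp only [Finset.mem_filter, Finset.mem_product, Finset.mem_univ, true_and, and_true,
      Finset.mem_singleton]
  rw [this]; simp

theorem le_paDeg_of_lt {t m : ℕ} (ξ : PAConfig t m) {s x : Fin t} (j : Fin m) (h : x < s) :
    m ≤ paDeg ξ (s.val + 1) j.val (x.val + 1) := by
  rw [paDeg_succ_eq]
  calc m = ∑ u : Fin t × Fin m, if u.1 = x then 1 else 0 := by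
        rw [Finset.sum_boole]; simp [card_filter_fst_eq]
    _ ≤ _ := by
        refine Finset.sum_le_sum fun u _ => ?_
        by_cases hu : u.1 = x
        · have : paBefore u s j := Or.inl (hu ▸ h)
          simp [hu, this]
        · simp [hu]

theorem paDeg_self_ge {t m : ℕ} (ξ : PAConfig t m) (s : Fin t) (j : Fin m) :
    j.val ≤ paDeg ξ (s.val + 1) j.val (s.val + 1) := by
  rw [paDeg_succ_eq]
  calc j.val = (({s} : Finset (Fin t)) ×ˢ Finset.Iio j).card := by simp
    _ = ∑ u : Fin t × Fin m, if u ∈ ({s} : Finset (Fin t)) ×ˢ Finset.Iio j then 1 else 0 := by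
        rw [Finset.sum_boole, Finset.filter_mem_eq_inter, Finset.univ_inter, Nat.cast_id]
    _ ≤ _ := by
        refine Finset.sum_le_sum fun u _ => ?_
        simp only [Finset.mem_product, Finset.mem_singleton, Finset.mem_Iio]
        by_cases hu : u.1 = s ∧ u.2 < j
        · have : paBefore u s j := Or.inr hu
          simp [hu, this]
        · rw [if_neg hu]
          exact Nat.zero_le _

theorem card_paBefore {t m : ℕ} (s : Fin t) (j : Fin m) :
    ((univ : Finset (Fin t × Fin m)).filter (fun u => paBefore u s j)).card = s * m + j := by
  have : (univ : Finset (Fin t × Fin m)).filter (fun u => paBefore u s j) =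
      (Finset.Iio s ×ˢ univ) ∪ ({s} ×ˢ Finset.Iio j) := by
    ext u
    rw [Finset.mem_filter]
    simp only [paBefore, Finset.mem_univ, true_and, and_true, Finset.mem_union,
      Finset.mem_product, Finset.mem_Iio, Finset.mem_singleton]
  rw [this, Finset.card_union_of_disjoint]
  · simp
  · rw [Finset.disjoint_left]
    intro u hu hu'
    simp only [Finset.mem_product, Finset.mem_Iio, Finset.mem_singleton] at hu hu'
    exact absurd hu'.1 hu.1.ne

theorem sum_paDeg {t m : ℕ} (ξ : PAConfig t m) (s : Fin t) (j : Fin m) :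
    ∑ x : Fin t, paDeg ξ (s.val + 1) j.val (x.val + 1) = 2 * (s * m + j) := by
  simp_rw [paDeg_succ_eq]
  rw [Finset.sum_comm, ← card_paBefore, Finset.card_filter, Finset.mul_sum]
  refine Finset.sum_congr rfl fun u _ => ?_
  split_ifs
  · rw [Finset.sum_add_distrib]; simp
  · simp

/-- The conditional probability that the `j`-th edge (0-based) of `s` is attached to `x`. -/
def paKernel {t m : ℕ} (δ : ℝ) (ξ : PAConfig t m) (s : Fin t) (j : Fin m) (x : Fin t) : ℝ :=
  if x.val = s.val then
    ((paDeg ξ (s.val + 1) j.val (s.val + 1) : ℝ) + 1 + ((j.val : ℝ) + 1) * δ / m) /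
      paC m δ (s.val + 1) (j.val + 1)
  else if x.val < s.val then
    ((paDeg ξ (s.val + 1) j.val (x.val + 1) : ℝ) + δ) / paC m δ (s.val + 1) (j.val + 1)
  else 0

theorem paWeight_eq_prod_paKernel {t m : ℕ} (δ : ℝ) (ξ : PAConfig t m) :
    paWeight t m δ ξ = ∏ s : Fin t, ∏ j : Fin m, paKernel δ ξ s j (ξ s j) := rfl

theorem paKernel_congr {t m : ℕ} {δ : ℝ} {ξ ξ' : PAConfig t m} {s : Fin t} {j : Fin m}
    (h : ∀ u : Fin t × Fin m, paBefore u s j → ξ u.1 u.2 = ξ' u.1 u.2) (x : Fin t) :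
    paKernel δ ξ s j x = paKernel δ ξ' s j x := by
  simp only [paKernel, paDeg_congr h]

section Kernel

variable {t m : ℕ} {δ : ℝ}

theorem paC_eq (s j : ℕ) :
    paC m δ (s + 1) (j + 1) = (m * s + j) * (2 + δ / m) + (1 + δ / m) := by
  simp only [paC, Nat.cast_add, Nat.cast_one]; ring

theorem neg_one_lt_div (hm : 2 ≤ m) (hδ₁ : -(m : ℝ) < δ) : -1 < δ / m := by
  have : (0 : ℝ) < m := by positivity
  rw [lt_div_iff₀ this]; linarith

theorem paC_pos (hm : 2 ≤ m) (hδ₁ : -(m : ℝ) < δ) (s j : ℕ) : 0 < paC m δ (s + 1) (j + 1) := by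
  rw [paC_eq]
  have := neg_one_lt_div hm hδ₁
  have h2 : (0 : ℝ) ≤ (m * s + j) * (2 + δ / m) := mul_nonneg (by positivity) (by linarith)
  linarith

theorem le_paC (hm : 2 ≤ m) (hδ₁ : -(m : ℝ) < δ) (s j : ℕ) :
    (m * s : ℝ) ≤ paC m δ (s + 1) (j + 1) := by
  rw [paC_eq]
  have := neg_one_lt_div hm hδ₁
  have h2 : (m * s + j : ℝ) * 1 ≤ (m * s + j) * (2 + δ / m) :=
    mul_le_mul_of_nonneg_left (by linarith) (by positivity)
  have : (0 : ℝ) ≤ j := by positivity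
  linarith

theorem paC_le (hm : 2 ≤ m) (hδ₂ : δ < 0) (s : Fin t) (j : Fin m) :
    paC m δ (s.val + 1) (j.val + 1) ≤ 2 * m * t := by
  rw [paC_eq]
  have hm' : (0 : ℝ) < m := by positivity
  have hd : δ / m ≤ 0 := div_nonpos_of_nonpos_of_nonneg hδ₂.le hm'.le
  have h2 : (m * s.val + j.val : ℝ) * (2 + δ / m) ≤ (m * s.val + j.val) * 2 :=
    mul_le_mul_of_nonneg_left (by linarith) (by positivity)
  have h3 : (m * s.val + j.val + 1 : ℝ) ≤ m * t := by
    have h4 : m * s.val + j.val + 1 ≤ m * t := by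
      calc m * s.val + j.val + 1 ≤ m * s.val + m := by have := j.2; omega
        _ = m * (s.val + 1) := by ring
        _ ≤ m * t := Nat.mul_le_mul_left _ s.2
    exact_mod_cast h4
  nlinarith

theorem paKernel_nonneg (hm : 2 ≤ m) (hδ₁ : -(m : ℝ) < δ) (ξ : PAConfig t m) (s : Fin t)
    (j : Fin m) (x : Fin t) : 0 ≤ paKernel δ ξ s j x := by
  have hc := paC_pos hm hδ₁ s j
  unfold paKernel
  split_ifs with h1 h2
  · refine div_nonneg ?_ hc.le
    have h3 : (j.val : ℝ) ≤ paDeg ξ (s.val + 1) j.val (s.val + 1) := by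
      exact_mod_cast paDeg_self_ge ξ s j
    have h4 := neg_one_lt_div hm hδ₁
    have h5 : ((j.val : ℝ) + 1) * (-1) ≤ (j.val + 1) * (δ / m) :=
      mul_le_mul_of_nonneg_left h4.le (by positivity)
    rw [mul_div_assoc]; linarith
  · refine div_nonneg ?_ hc.le
    have : (m : ℝ) ≤ paDeg ξ (s.val + 1) j.val (x.val + 1) := by
      exact_mod_cast le_paDeg_of_lt ξ j (Fin.lt_def.2 h2)
    linarith
  · exact le_rfl

theorem paWeight_nonneg (hm : 2 ≤ m) (hδ₁ : -(m : ℝ) < δ) (ξ : PAConfig t m) :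
    0 ≤ paWeight t m δ ξ := by
  rw [paWeight_eq_prod_paKernel]
  exact Finset.prod_nonneg fun s _ => Finset.prod_nonneg fun j _ => paKernel_nonneg hm hδ₁ _ _ _ _

theorem le_paKernel_of_lt (hm : 2 ≤ m) (hδ₁ : -(m : ℝ) < δ) (hδ₂ : δ < 0) (ξ : PAConfig t m)
    {s : Fin t} (j : Fin m) {x : Fin t} (h : x < s) :
    (m + δ) / (2 * m * t) ≤ paKernel δ ξ s j x := by
  have hx : x.val < s.val := h
  rw [paKernel, if_neg hx.ne, if_pos hx]
  have : (m : ℝ) ≤ paDeg ξ (s.val + 1) j.val (x.val + 1) := by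
    exact_mod_cast le_paDeg_of_lt ξ j h
  exact div_le_div₀ (by linarith) (by linarith) (paC_pos hm hδ₁ _ _) (paC_le hm hδ₂ s j)

theorem paDeg_eq_zero_of_lt {ξ : PAConfig t m} {s : Fin t} {j : Fin m}
    (h : ∀ u : Fin t × Fin m, paBefore u s j → ξ u.1 u.2 ≤ u.1) {x : Fin t} (hx : s < x) :
    paDeg ξ (s.val + 1) j.val (x.val + 1) = 0 := by
  rw [paDeg_succ_eq]
  refine Finset.sum_eq_zero fun u _ => ?_
  split_ifs with hb h1 h2 h2
  · exact absurd h2 (by rcases hb with hb | hb <;> omega)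
  · have := h u hb
    exact absurd h1 (by rcases hb with hb | hb <;> omega)
  · exact absurd h2 (by rcases hb with hb | hb <;> omega)
  · rfl
  · rfl

theorem sum_paKernel (hm : 2 ≤ m) (hδ₁ : -(m : ℝ) < δ) {ξ : PAConfig t m} {s : Fin t} {j : Fin m}
    (h : ∀ u : Fin t × Fin m, paBefore u s j → ξ u.1 u.2 ≤ u.1) :
    ∑ x, paKernel δ ξ s j x = 1 := by
  have hc := paC_pos hm hδ₁ s j
  have hterm : ∀ x : Fin t, paKernel δ ξ s j x =
      ((paDeg ξ (s.val + 1) j.val (x.val + 1) : ℝ) + (if x < s then δ else 0) +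
        (if x = s then 1 + ((j.val : ℝ) + 1) * δ / m else 0)) /
          paC m δ (s.val + 1) (j.val + 1) := by
    intro x
    rcases lt_trichotomy x s with hx | hx | hx
    · have hx' : x.val < s.val := hx
      rw [paKernel, if_neg hx'.ne, if_pos hx', if_pos hx, if_neg hx.ne, add_zero]
    · subst hx
      rw [paKernel, if_pos rfl, if_neg (lt_irrefl _), if_pos rfl]
      congr 1; ring
    · have hx' : s.val < x.val := hx
      rw [paKernel, if_neg hx'.ne', if_neg hx'.not_gt, if_neg hx.not_gt, if_neg hx.ne',
        paDeg_eq_zero_of_lt h hx]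
      simp
  simp_rw [hterm]
  rw [← Finset.sum_div, div_eq_one_iff_eq hc.ne', Finset.sum_add_distrib, Finset.sum_add_distrib,
    ← Nat.cast_sum, sum_paDeg, paC_eq, ← Finset.sum_filter]
  have hcard : (univ.filter (fun x : Fin t => x < s)).card = s.val := by
    rw [Finset.filter_gt_eq_Iio]; simp
  have hm' : (m : ℝ) ≠ 0 := by positivity
  simp only [Finset.sum_const, hcard, Finset.sum_ite_eq', Finset.mem_univ, if_true, nsmul_eq_mul]
  push_cast
  field_simp
  ring

end Kernel

section Tree

/-- Number of vertices at depth less than `l` of the `m`-ary tree with heap indexing: the children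
of the node `a` are the nodes `m * a + 1 + j`, `j < m`. -/
def treeSize (m l : ℕ) : ℕ := ∑ i ∈ Finset.range l, m ^ i

variable {t m k : ℕ} {δ : ℝ}

theorem treeSize_succ (m l : ℕ) : treeSize m (l + 1) = m * treeSize m l + 1 :=
  geom_sum_succ

theorem paik_eq_treeSize (m k : ℕ) : paik m k = treeSize m (k + 1) := rfl

theorem treeSize_le_succ (m l : ℕ) : treeSize m l ≤ treeSize m (l + 1) :=
  Finset.sum_le_sum_of_subset (Finset.range_mono (Nat.le_succ l))

theorem treeSize_mono (m : ℕ) : Monotone (treeSize m) :=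
  monotone_nat_of_le_succ (treeSize_le_succ m)

theorem child_lt_treeSize {l a : ℕ} (ha : a < treeSize m l) (j : Fin m) :
    m * a + 1 + j.val < treeSize m (l + 1) := by
  rw [treeSize_succ]
  have h : m * (a + 1) ≤ m * treeSize m l := Nat.mul_le_mul_left _ ha
  rw [mul_add] at h
  have := j.2
  omega

theorem child_injective {a a' : ℕ} {j j' : Fin m}
    (h : m * a + 1 + j.val = m * a' + 1 + j'.val) : a = a' ∧ j = j' := by
  have hm : 0 < m := j.pos
  have h1 : j.val + m * a = j'.val + m * a' := by omega
  have h2 : a = a' := by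
    have := congrArg (· / m) h1
    simpa [Nat.add_mul_div_left _ _ hm, Nat.div_eq_of_lt j.2, Nat.div_eq_of_lt j'.2] using this
  subst h2
  exact ⟨rfl, Fin.ext (by omega)⟩

theorem exists_parent {l a : ℕ} (hm : 0 < m) (h0 : a ≠ 0) (ha : a < treeSize m (l + 1)) :
    ∃ p < treeSize m l, ∃ j : Fin m, a = m * p + 1 + j.val := by
  rw [treeSize_succ] at ha
  refine ⟨(a - 1) / m, (Nat.div_lt_iff_lt_mul hm).2 (by rw [mul_comm]; omega),
    ⟨(a - 1) % m, Nat.mod_lt _ hm⟩, ?_⟩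
  have := Nat.div_add_mod (a - 1) m
  simp only
  omega

/-- `e` places the `m`-ary tree of depth `k` into `[t]`, with the root in `[t] \ [t/2]`, all other
vertices in `[t/2] \ [t/4]`, and in decreasing order. -/
structure IsTreePlacement (t m k : ℕ) (e : ℕ → Fin t) : Prop where
  anti : ∀ a b, a < b → b < treeSize m (k + 1) → e b < e a
  root : t / 2 ≤ (e 0).val
  lower : ∀ a, a ≠ 0 → a < treeSize m (k + 1) → t / 4 ≤ (e a).val
  upper : ∀ a, a ≠ 0 → a < treeSize m (k + 1) → (e a).val < t / 2

/-- Attaching the `j`-th edge of `s` to `x` is compatible with `e` being a minimally-connected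
tree: tree edges are attached as prescribed, and other edges avoid the tree. -/
def TreeEdge (m k : ℕ) (e : ℕ → Fin t) (s : Fin t) (j : Fin m) (x : Fin t) : Prop :=
  (∀ a < treeSize m k, e a = s → x = e (m * a + 1 + j.val)) ∧
    ((∀ a < treeSize m k, e a ≠ s) → ∀ b < treeSize m (k + 1), x ≠ e b)

variable {e : ℕ → Fin t}

theorem IsTreePlacement.inj (he : IsTreePlacement t m k e) {a b : ℕ}
    (ha : a < treeSize m (k + 1)) (hb : b < treeSize m (k + 1)) (h : e a = e b) : a = b := by
  rcases lt_trichotomy a b with hab | hab | hab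
  · exact absurd h (he.anti a b hab hb).ne'
  · exact hab
  · exact absurd h (he.anti b a hab ha).ne

theorem TreeEdge.exists_of_eq {s : Fin t} {j : Fin m} {x : Fin t} (h : TreeEdge m k e s j x)
    {b : ℕ} (hb : b < treeSize m (k + 1)) (hx : x = e b) :
    ∃ a < treeSize m k, e a = s ∧ x = e (m * a + 1 + j.val) := by
  by_contra! hcon
  by_cases hs : ∀ a < treeSize m k, e a ≠ s
  · exact h.2 hs b hb hx
  · push Not at hs
    obtain ⟨a, ha, has⟩ := hs
    exact hcon a ha has (h.1 a ha has)

/-- At most one edge satisfying `TreeEdge` is attached to a given tree vertex. -/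
theorem IsTreePlacement.edge_unique (he : IsTreePlacement t m k e) {b : ℕ}
    (hb : b < treeSize m (k + 1)) {s s' : Fin t} {j j' : Fin m}
    (h : TreeEdge m k e s j (e b)) (h' : TreeEdge m k e s' j' (e b)) : s = s' ∧ j = j' := by
  obtain ⟨a, ha, rfl, h1⟩ := h.exists_of_eq hb rfl
  obtain ⟨a', ha', rfl, h1'⟩ := h'.exists_of_eq hb rfl
  have := he.inj hb (child_lt_treeSize ha j) h1
  have h2 := he.inj hb (child_lt_treeSize ha' j') h1'
  obtain ⟨rfl, rfl⟩ := child_injective (this.symm.trans h2)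
  exact ⟨rfl, rfl⟩

theorem IsTreePlacement.paDeg_le (he : IsTreePlacement t m k e) {ξ : PAConfig t m} {s : Fin t}
    {j : Fin m} (h : ∀ u : Fin t × Fin m, paBefore u s j → TreeEdge m k e u.1 u.2 (ξ u.1 u.2))
    {b : ℕ} (hb : b < treeSize m (k + 1)) :
    paDeg ξ (s.val + 1) j.val ((e b).val + 1) ≤ m + 1 := by
  rw [paDeg_succ_eq]
  calc _ ≤ ∑ u : Fin t × Fin m, ((if paBefore u s j ∧ ξ u.1 u.2 = e b then 1 else 0) +
          (if u.1 = e b then 1 else 0)) := by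
        refine Finset.sum_le_sum fun u _ => ?_
        by_cases hu : paBefore u s j <;> simp [hu]
    _ = ((univ : Finset (Fin t × Fin m)).filter
          (fun u => paBefore u s j ∧ ξ u.1 u.2 = e b)).card + m := by
        rw [Finset.sum_add_distrib, Finset.sum_boole, Finset.sum_boole, card_filter_fst_eq]
        rfl
    _ ≤ m + 1 := by
        rw [add_comm]
        refine Nat.add_le_add_left (Finset.card_le_one.2 fun u hu u' hu' => ?_) m
        simp only [Finset.mem_filter, Finset.mem_univ, true_and] at hu hu'
        have h1 := h u hu.1
        have h2 := h u' hu'.1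
        rw [hu.2] at h1
        rw [hu'.2] at h2
        exact Prod.ext_iff.2 (he.edge_unique hb h1 h2)

theorem IsTreePlacement.lower' (he : IsTreePlacement t m k e) {a : ℕ}
    (ha : a < treeSize m (k + 1)) : t / 4 ≤ (e a).val := by
  by_cases h0 : a = 0
  · subst h0
    exact le_trans (by omega) he.root
  · exact he.lower a h0 ha

theorem IsTreePlacement.paKernel_le (he : IsTreePlacement t m k e) (hm : 2 ≤ m)
    (hδ₁ : -(m : ℝ) < δ) (hδ₂ : δ < 0) (ht : 0 < t / 4) {ξ : PAConfig t m} {s : Fin t} {j : Fin m}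
    (h : ∀ u : Fin t × Fin m, paBefore u s j → TreeEdge m k e u.1 u.2 (ξ u.1 u.2))
    {b : ℕ} (hb : b < treeSize m (k + 1)) :
    paKernel δ ξ s j (e b) ≤ 2 / (t / 4 : ℕ) := by
  have hq : (0 : ℝ) < (t / 4 : ℕ) := by exact_mod_cast ht
  have hm' : (2 : ℝ) ≤ m := by exact_mod_cast hm
  have hdeg : (paDeg ξ (s.val + 1) j.val ((e b).val + 1) : ℝ) ≤ m + 1 := by
    exact_mod_cast he.paDeg_le h hb
  have hfrac : ∀ y : ℝ, y ≤ m + 2 → (e b).val ≤ s.val →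
      y / paC m δ (s.val + 1) (j.val + 1) ≤ 2 / (t / 4 : ℕ) := by
    intro y hy hs
    have h1 : ((t / 4 : ℕ) : ℝ) ≤ s.val := by exact_mod_cast (he.lower' hb).trans hs
    have h2 := le_paC hm hδ₁ s.val j.val
    have h3 : (m : ℝ) * (t / 4 : ℕ) ≤ m * s.val := mul_le_mul_of_nonneg_left h1 (by linarith)
    rw [div_le_div_iff₀ (paC_pos hm hδ₁ _ _) hq]
    have h4 : y * (t / 4 : ℕ) ≤ (2 * m) * (t / 4 : ℕ) :=
      mul_le_mul_of_nonneg_right (by linarith) hq.le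
    linarith
  unfold paKernel
  split_ifs with h1 h2
  · refine hfrac _ ?_ h1.le
    rw [h1] at hdeg
    have : ((j.val : ℝ) + 1) * δ / m ≤ 0 :=
      div_nonpos_of_nonpos_of_nonneg (mul_nonpos_of_nonneg_of_nonpos (by positivity) hδ₂.le)
        (by linarith)
    linarith
  · exact hfrac _ (by linarith) h2.le
  · positivity

/-- Lower bound for the conditional probability of `TreeEdge`. -/
def treeEdgeBound (t m k : ℕ) (δ : ℝ) (e : ℕ → Fin t) (s : Fin t) : ℝ :=
  if ∃ a < treeSize m k, e a = s then (m + δ) / (2 * m * t)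
  else 1 - treeSize m (k + 1) * (2 / (t / 4 : ℕ))

theorem IsTreePlacement.bound_le (he : IsTreePlacement t m k e) (hm : 2 ≤ m)
    (hδ₁ : -(m : ℝ) < δ) (hδ₂ : δ < 0) (ht : 0 < t / 4) {ξ : PAConfig t m} {s : Fin t} {j : Fin m}
    (h : ∀ u : Fin t × Fin m, paBefore u s j →
      ξ u.1 u.2 ≤ u.1 ∧ TreeEdge m k e u.1 u.2 (ξ u.1 u.2)) :
    treeEdgeBound t m k δ e s ≤
      ∑ x, if TreeEdge m k e s j x then paKernel δ ξ s j x else 0 := by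
  unfold treeEdgeBound
  split_ifs with hs
  · obtain ⟨a, ha, rfl⟩ := hs
    have hN := treeSize_le_succ m k
    have hc := child_lt_treeSize ha j
    have hcond : TreeEdge m k e (e a) j (e (m * a + 1 + j.val)) := by
      refine ⟨fun a' ha' h' => ?_, fun h' => absurd rfl (h' a ha)⟩
      rw [he.inj (ha'.trans_le hN) (ha.trans_le hN) h']
    have hlt : e (m * a + 1 + j.val) < e a := he.anti _ _ (by nlinarith) hc
    calc _ ≤ paKernel δ ξ (e a) j (e (m * a + 1 + j.val)) :=
          le_paKernel_of_lt hm hδ₁ hδ₂ ξ j hlt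
      _ = if TreeEdge m k e (e a) j (e (m * a + 1 + j.val)) then
            paKernel δ ξ (e a) j (e (m * a + 1 + j.val)) else 0 := (if_pos hcond).symm
      _ ≤ _ := Finset.single_le_sum (f := fun x => if TreeEdge m k e (e a) j x then
            paKernel δ ξ (e a) j x else 0) (fun x _ => by
              split_ifs
              · exact paKernel_nonneg hm hδ₁ _ _ _ _
              · exact le_rfl) (Finset.mem_univ _)
  · push Not at hs
    set T : Finset (Fin t) := (Finset.range (treeSize m (k + 1))).image e with hT
    have hle : ∀ x, paKernel δ ξ s j x - (if x ∈ T then paKernel δ ξ s j x else 0) ≤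
        if TreeEdge m k e s j x then paKernel δ ξ s j x else 0 := by
      intro x
      by_cases hx : x ∈ T
      · rw [if_pos hx, sub_self]
        split_ifs
        · exact paKernel_nonneg hm hδ₁ _ _ _ _
        · exact le_rfl
      · rw [if_neg hx, sub_zero, if_pos]
        refine ⟨fun a ha h' => absurd h' (hs a ha), fun _ b hb hxb => hx ?_⟩
        rw [hT, Finset.mem_image]
        exact ⟨b, Finset.mem_range.2 hb, hxb.symm⟩
    refine le_trans ?_ (Finset.sum_le_sum fun x _ => hle x)
    rw [Finset.sum_sub_distrib, sum_paKernel hm hδ₁ fun u hu => (h u hu).1, ← Finset.sum_filter,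
      Finset.filter_mem_eq_inter, Finset.univ_inter]
    refine sub_le_sub_left ?_ 1
    calc ∑ x ∈ T, paKernel δ ξ s j x ≤ T.card • (2 / (t / 4 : ℕ) : ℝ) := by
          refine Finset.sum_le_card_nsmul _ _ _ fun x hx => ?_
          obtain ⟨b, hb, rfl⟩ := Finset.mem_image.1 hx
          exact he.paKernel_le hm hδ₁ hδ₂ ht (fun u hu => (h u hu).2) (Finset.mem_range.1 hb)
      _ ≤ _ := by
          rw [nsmul_eq_mul]
          refine mul_le_mul_of_nonneg_right ?_ (by positivity)
          exact_mod_cast Finset.card_image_le.trans (Finset.card_range _).le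

theorem sum_paConfig (f : PAConfig t m → ℝ) :
    ∑ ξ, f ξ = ∑ η : (Fin t ×ₗ Fin m) → Fin t, f fun s j => η (toLex (s, j)) := by
  symm
  exact Fintype.sum_equiv ((Equiv.arrowCongr ofLex (Equiv.refl _)).trans
    (Equiv.curry (Fin t) (Fin m) (Fin t))) _ _ fun η => rfl

theorem prod_lex (f : Fin t ×ₗ Fin m → ℝ) :
    ∏ i, f i = ∏ s : Fin t, ∏ j : Fin m, f (toLex (s, j)) := by
  rw [← Fintype.prod_prod_type']
  exact (Fintype.prod_equiv toLex _ _ fun _ => rfl).symm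

theorem IsTreePlacement.prod_bound_le (he : IsTreePlacement t m k e) (hm : 2 ≤ m)
    (hδ₁ : -(m : ℝ) < δ) (hδ₂ : δ < 0) (ht : 2 * treeSize m (k + 1) ≤ t / 4) :
    ∏ s : Fin t, ∏ _j : Fin m, treeEdgeBound t m k δ e s ≤
      paProb t m δ (fun ξ => ∀ s j, TreeEdge m k e s j (ξ s j)) := by
  have hN : 0 < treeSize m (k + 1) := by rw [treeSize_succ]; omega
  have hq : 0 < t / 4 := by omega
  have htpos : 0 < t := by omega
  have : Nonempty (Fin t) := ⟨⟨0, htpos⟩⟩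
  have hprob : paProb t m δ (fun ξ => ∀ s j, TreeEdge m k e s j (ξ s j)) =
      ∑ η : (Fin t ×ₗ Fin m) → Fin t, ∏ i : Fin t ×ₗ Fin m,
        if TreeEdge m k e (ofLex i).1 (ofLex i).2 (η i) then
          paKernel δ (fun s j => η (toLex (s, j))) (ofLex i).1 (ofLex i).2 (η i) else 0 := by
    rw [paProb, Finset.sum_filter, sum_paConfig]
    refine Finset.sum_congr rfl fun η _ => ?_
    rw [prod_lex, paWeight_eq_prod_paKernel]
    split_ifs with h
    · exact Finset.prod_congr rfl fun s _ => Finset.prod_congr rfl fun j _ =>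
        (if_pos (h s j)).symm
    · push Not at h
      obtain ⟨s, j, h⟩ := h
      symm
      refine Finset.prod_eq_zero (Finset.mem_univ s) (Finset.prod_eq_zero (Finset.mem_univ j) ?_)
      exact if_neg h
  have hprod := prod_lex (fun i : Fin t ×ₗ Fin m => treeEdgeBound t m k δ e (ofLex i).1)
  simp only [ofLex_toLex] at hprod
  rw [hprob, ← hprod]
  have hbefore : ∀ (u : Fin t × Fin m) (i : Fin t ×ₗ Fin m),
      paBefore u (ofLex i).1 (ofLex i).2 → toLex u < i := by
    intro u i h
    rw [Prod.Lex.lt_iff]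
    exact h
  refine prod_le_sum_prod_of_step _ _ ?_ ?_ ?_ ?_
  · intro i η
    split_ifs
    · exact paKernel_nonneg hm hδ₁ _ _ _ _
    · exact le_rfl
  · intro i
    unfold treeEdgeBound
    split_ifs
    · exact div_nonneg (by linarith) (by positivity)
    · have hq' : (0 : ℝ) < (t / 4 : ℕ) := by exact_mod_cast hq
      rw [sub_nonneg, mul_div_assoc', div_le_one hq']
      have : (2 * treeSize m (k + 1) : ℝ) ≤ (t / 4 : ℕ) := by exact_mod_cast ht
      linarith
  · intro i η η' h
    have hη : ∀ u : Fin t × Fin m, paBefore u (ofLex i).1 (ofLex i).2 →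
        (fun s j => η (toLex (s, j))) u.1 u.2 = (fun s j => η' (toLex (s, j))) u.1 u.2 :=
      fun u hu => h (toLex u) (hbefore u i hu).le
    rw [h i le_rfl, paKernel_congr (ξ := fun s j => η (toLex (s, j)))
      (ξ' := fun s j => η' (toLex (s, j))) hη]
  · intro i η h
    refine (he.bound_le hm hδ₁ hδ₂ hq (ξ := fun s j => η (toLex (s, j))) (j := (ofLex i).2)
      fun u hu => ?_).trans (Finset.sum_le_sum fun x _ => ?_)
    · have h1 := ite_ne_right_iff.1 (h _ (hbefore u i hu))
      refine ⟨?_, h1.1⟩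
      by_contra! hlt
      refine h1.2 ?_
      have hlt' : u.1.val < (η (toLex u)).val := hlt
      exact (if_neg hlt'.ne').trans (if_neg hlt'.not_gt)
    · rw [Function.update_self]
      refine le_of_eq ?_
      congr 1
      refine paKernel_congr (fun u hu => ?_) _
      exact (Function.update_of_ne (hbefore u i hu).ne _ _).symm

theorem IsTreePlacement.pow_le_prod_bound (he : IsTreePlacement t m k e) (hm : 2 ≤ m)
    (ht : 2 * treeSize m (k + 1) ≤ t / 4) (hδ₁ : -(m : ℝ) < δ) :
    ((m + δ) / (2 * m * t)) ^ (m * treeSize m k) *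
      (1 - treeSize m (k + 1) * (2 / (t / 4 : ℕ)) : ℝ) ^ (m * t) ≤
      ∏ s : Fin t, ∏ _j : Fin m, treeEdgeBound t m k δ e s := by
  have hN : 0 < treeSize m (k + 1) := by rw [treeSize_succ]; omega
  have hq : 0 < t / 4 := by omega
  have hq' : (0 : ℝ) < (t / 4 : ℕ) := by exact_mod_cast hq
  have hx0 : (0 : ℝ) ≤ 1 - treeSize m (k + 1) * (2 / (t / 4 : ℕ)) := by
    rw [sub_nonneg, mul_div_assoc', div_le_one hq']
    have : (2 * treeSize m (k + 1) : ℝ) ≤ (t / 4 : ℕ) := by exact_mod_cast ht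
    linarith
  have hx1 : (1 - treeSize m (k + 1) * (2 / (t / 4 : ℕ)) : ℝ) ≤ 1 := by
    have : (0 : ℝ) ≤ treeSize m (k + 1) * (2 / (t / 4 : ℕ)) := by positivity
    linarith
  have hcard : ((univ : Finset (Fin t)).filter (fun s => ∃ a < treeSize m k, e a = s)).card =
      treeSize m k := by
    have : (univ : Finset (Fin t)).filter (fun s => ∃ a < treeSize m k, e a = s) =
        (Finset.range (treeSize m k)).image e := by
      ext s; simp
    rw [this, Finset.card_image_of_injOn, Finset.card_range]
    intro a ha b hb h
    have hle := treeSize_le_succ m k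
    simp only [Finset.coe_range, Set.mem_Iio] at ha hb
    exact he.inj (ha.trans_le hle) (hb.trans_le hle) h
  have hbase : (0 : ℝ) ≤ (m + δ) / (2 * m * t) := div_nonneg (by linarith) (by positivity)
  simp only [Finset.prod_const, Finset.card_univ, Fintype.card_fin]
  rw [Finset.prod_pow]
  simp only [treeEdgeBound]
  rw [Finset.prod_ite, Finset.prod_const, Finset.prod_const, hcard, mul_pow, ← pow_mul, ← pow_mul,
    mul_comm m, mul_comm m]
  refine mul_le_mul_of_nonneg_left (pow_le_pow_of_le_one hx0 hx1 ?_) (pow_nonneg hbase _)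
  refine Nat.mul_le_mul_right _ ((Finset.card_le_univ _).trans (Fintype.card_fin t).le)

end Tree

section Ball

variable {V : Type*} {A : V → V → Prop}

theorem reachIn_zero (u : V) : reachIn A u u 0 := ⟨fun _ => u, rfl, rfl, fun i hi => by omega⟩

theorem reachIn.snoc {u v w : V} {l : ℕ} (h : reachIn A u v l) (hw : A v w) :
    reachIn A u w (l + 1) := by
  obtain ⟨p, h0, hl, hp⟩ := h
  refine ⟨fun i => if i ≤ l then p i else w, by simp [h0], by simp, fun i hi => ?_⟩
  rcases Nat.lt_succ_iff_lt_or_eq.1 hi with hi | rfl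
  · simpa [hi.le, Nat.succ_le_of_lt hi] using hp i hi
  · simpa [hl] using hw

theorem graphDist_le_iff {u v : V} {k : ℕ} :
    graphDist A u v ≤ k ↔ ∃ l ≤ k, reachIn A u v l := by
  constructor
  · intro h
    by_contra! hcon
    have : ((k + 1 : ℕ) : ℕ∞) ≤ graphDist A u v := by
      refine le_iInf₂ fun l hl => ?_
      by_contra! hlt
      exact hcon l (by have := Nat.cast_lt.1 hlt; omega) hl
    have h2 := Nat.cast_le.1 (this.trans h)
    omega
  · rintro ⟨l, hl, h⟩
    exact (iInf₂_le l h).trans (by exact_mod_cast hl)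

end Ball

section MinConn

variable {t m k : ℕ} {e : ℕ → Fin t} {ξ : PAConfig t m}

theorem attach_child (hξ : ∀ s j, TreeEdge m k e s j (ξ s j)) {a : ℕ} (ha : a < treeSize m k)
    (j : Fin m) :
    ξ (e a) j = e (m * a + 1 + j.val) :=
  (hξ (e a) j).1 a ha rfl

theorem IsTreePlacement.exists_of_walk (he : IsTreePlacement t m k e)
    (hξ : ∀ s j, TreeEdge m k e s j (ξ s j)) {p : ℕ → Fin t} {l : ℕ} (hl : l ≤ k)
    (h0 : p 0 = e 0) (hp : ∀ i < l, paAdj ξ (p i) (p (i + 1))) :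
    ∃ a < treeSize m (l + 1), p l = e a := by
  induction l with
  | zero => exact ⟨0, by rw [treeSize_succ]; omega, h0⟩
  | succ l ih =>
    obtain ⟨a, ha, hpa⟩ := ih (by omega) fun i hi => hp i (by omega)
    have hak : a < treeSize m k := ha.trans_le (treeSize_mono m hl)
    have haN := hak.trans_le (treeSize_le_succ m k)
    obtain ⟨j, hj | hj⟩ := hp l (Nat.lt_succ_self l)
    · refine ⟨m * a + 1 + j.val, child_lt_treeSize ha j, ?_⟩
      rw [← hj, hpa, attach_child hξ hak]
    · obtain ⟨b, hb, hbs, hbx⟩ := (hξ (p (l + 1)) j).exists_of_eq haN (hj.trans hpa)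
      rw [hj, hpa] at hbx
      have hab := he.inj haN (child_lt_treeSize hb j) hbx
      refine ⟨b, lt_of_le_of_lt ?_ (ha.trans_le (treeSize_le_succ m (l + 1))), hbs.symm⟩
      have : 1 * b ≤ m * b := Nat.mul_le_mul_right _ j.pos
      omega

theorem exists_reachIn (hm : 0 < m)
    (hξ : ∀ s j, TreeEdge m k e s j (ξ s j)) {l : ℕ} (hl : l ≤ k) :
    ∀ a < treeSize m (l + 1), ∃ i ≤ l, reachIn (paAdj ξ) (e 0) (e a) i := by
  induction l with
  | zero =>
    intro a ha
    have : a = 0 := by simpa [treeSize] using ha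
    subst this
    exact ⟨0, le_rfl, reachIn_zero _⟩
  | succ l ih =>
    intro a ha
    by_cases h0 : a = 0
    · subst h0
      exact ⟨0, Nat.zero_le _, reachIn_zero _⟩
    · obtain ⟨p, hp, j, rfl⟩ := exists_parent hm h0 ha
      obtain ⟨i, hi, hr⟩ := ih (by omega) p hp
      exact ⟨i + 1, by omega, hr.snoc ⟨j, Or.inl
        (attach_child hξ (hp.trans_le (treeSize_mono m hl)) j)⟩⟩

theorem IsTreePlacement.paBallF_eq (he : IsTreePlacement t m k e) (hm : 0 < m)
    (hξ : ∀ s j, TreeEdge m k e s j (ξ s j)) :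
    paBallF ξ (e 0) k = (Finset.range (treeSize m (k + 1))).image e := by
  ext u
  simp only [paBallF, Finset.mem_filter, Finset.mem_univ, true_and, graphDist_le_iff,
    Finset.mem_image, Finset.mem_range]
  constructor
  · rintro ⟨l, hl, p, h0, rfl, hp⟩
    obtain ⟨a, ha, h⟩ := he.exists_of_walk hξ hl h0 hp
    exact ⟨a, ha.trans_le (treeSize_mono m (by omega)), h.symm⟩
  · rintro ⟨a, ha, rfl⟩
    exact exists_reachIn hm hξ le_rfl a ha

theorem paDegT_eq (ξ : PAConfig t m) (v : Fin t) :
    paDegT ξ v = ((univ : Finset (Fin t × Fin m)).filter (fun u => ξ u.1 u.2 = v)).card + m := by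
  have h := card_filter_fst_eq (m := m) v
  suffices paDegT ξ v = ((univ : Finset (Fin t × Fin m)).filter (fun u => ξ u.1 u.2 = v)).card +
      ((univ : Finset (Fin t × Fin m)).filter (fun u => u.1 = v)).card by rw [this, h]
  unfold paDegT paDeg
  rw [Finset.card_filter, Finset.card_filter, ← Finset.sum_add_distrib]
  refine Finset.sum_congr rfl fun u _ => ?_
  rw [if_pos (by have := u.1.2; have := u.2.2; omega)]
  simp only [Fin.ext_iff, Nat.add_right_cancel_iff]

theorem IsTreePlacement.paDegT_root (he : IsTreePlacement t m k e)
    (hξ : ∀ s j, TreeEdge m k e s j (ξ s j)) : paDegT ξ (e 0) = m := by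
  have h0 : 0 < treeSize m (k + 1) := by rw [treeSize_succ]; omega
  rw [paDegT_eq, Finset.card_eq_zero.2, zero_add]
  rw [Finset.filter_eq_empty_iff]
  rintro u - hu
  obtain ⟨a, ha, -, hx⟩ := (hξ u.1 u.2).exists_of_eq h0 hu
  have := he.inj h0 (child_lt_treeSize ha u.2) (hu.symm.trans hx)
  omega

theorem IsTreePlacement.paDegT_of_ne_zero (he : IsTreePlacement t m k e) (hm : 0 < m)
    (hξ : ∀ s j, TreeEdge m k e s j (ξ s j)) {b : ℕ} (hb0 : b ≠ 0)
    (hb : b < treeSize m (k + 1)) : paDegT ξ (e b) = m + 1 := by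
  rw [paDegT_eq, add_comm, Finset.card_eq_one.2]
  obtain ⟨p, hp, j, rfl⟩ := exists_parent hm hb0 hb
  refine ⟨(e p, j), Finset.eq_singleton_iff_unique_mem.2 ⟨?_, fun u hu => ?_⟩⟩
  · rw [Finset.mem_filter]
    exact ⟨Finset.mem_univ _, attach_child hξ hp j⟩
  · rw [Finset.mem_filter] at hu
    have h1 := hξ u.1 u.2
    have h2 := hξ (e p) j
    rw [hu.2] at h1
    rw [attach_child hξ hp j] at h2
    exact Prod.ext_iff.2 (he.edge_unique hb h1 h2)

theorem IsTreePlacement.paMinConn (he : IsTreePlacement t m k e) (hm : 0 < m)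
    (hξ : ∀ s j, TreeEdge m k e s j (ξ s j)) : paMinConn ξ (e 0) k := by
  have hle := treeSize_le_succ m k
  refine ⟨he.root, he.paDegT_root hξ, ?_, ?_, ?_⟩
  · intro u hu hne
    rw [he.paBallF_eq hm hξ, Finset.mem_image] at hu
    obtain ⟨b, hb, rfl⟩ := hu
    rw [Finset.mem_range] at hb
    have hb0 : b ≠ 0 := fun h => hne (h ▸ rfl)
    exact ⟨⟨he.lower b hb0 hb, he.upper b hb0 hb⟩, he.paDegT_of_ne_zero hm hξ hb0 hb⟩
  · rw [he.paBallF_eq hm hξ, Finset.card_image_of_injOn, Finset.card_range, paik_eq_treeSize]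
    intro a ha b hb h
    exact he.inj (by simpa using ha) (by simpa using hb) h
  · rw [he.paBallF_eq hm hξ, paik_eq_treeSize, treeSize_succ, Nat.add_sub_cancel]
    have himg : (univ : Finset (Fin t × Fin m)).filter (fun uj =>
        uj.1 ∈ (Finset.range (m * treeSize m k + 1)).image e ∧
          ξ uj.1 uj.2 ∈ (Finset.range (m * treeSize m k + 1)).image e) =
        (Finset.range (treeSize m k) ×ˢ (univ : Finset (Fin m))).image
          (fun aj => (e aj.1, aj.2)) := by
      rw [← treeSize_succ]
      ext ⟨s, j⟩
      simp only [Finset.mem_filter, Finset.mem_univ, true_and, Finset.mem_image, Finset.mem_range,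
        Finset.mem_product, and_true, Prod.exists, Prod.mk.injEq]
      constructor
      · rintro ⟨-, b, hb, hbx⟩
        obtain ⟨a, ha, has, -⟩ := (hξ s j).exists_of_eq hb hbx.symm
        exact ⟨a, j, ha, has, rfl⟩
      · rintro ⟨a, j', ha, rfl, rfl⟩
        exact ⟨⟨a, ha.trans_le hle, rfl⟩, _, child_lt_treeSize ha j',
          (attach_child hξ ha j').symm⟩
    rw [himg, Finset.card_image_of_injOn, Finset.card_product, Finset.card_range,
      Finset.card_univ, Fintype.card_fin, mul_comm]
    rintro ⟨a, j⟩ ha ⟨b, j'⟩ hb h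
    simp only [Finset.coe_product, Set.mem_prod, Finset.coe_range, Set.mem_Iio] at ha hb
    simp only [Prod.mk.injEq] at h ⊢
    exact ⟨he.inj (ha.1.trans_le hle) (hb.1.trans_le hle) h.1, h.2⟩

/-- The placement of the tree is determined by its root and the configuration. -/
theorem treePlacement_unique {e' : ℕ → Fin t} (hm : 0 < m) (h0 : e 0 = e' 0)
    (hξ : ∀ s j, TreeEdge m k e s j (ξ s j)) (hξ' : ∀ s j, TreeEdge m k e' s j (ξ s j)) :
    ∀ a < treeSize m (k + 1), e a = e' a := by
  intro a
  induction a using Nat.strong_induction_on with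
  | _ a ih =>
    intro ha
    by_cases ha0 : a = 0
    · rw [ha0, h0]
    · obtain ⟨p, hp, j, rfl⟩ := exists_parent hm ha0 ha
      have hpe := ih p (by nlinarith) (hp.trans_le (treeSize_le_succ m k))
      rw [← (hξ (e p) j).1 p hp rfl, ← (hξ' (e' p) j).1 p hp rfl, hpe]

/-- Position of the node `a` when the nodes `1, …, n` are placed in consecutive blocks of length
`b` of `[t/2] \ [t/4]`, in decreasing order, with offset `x` in each block. -/
def blockPos (t n b : ℕ) (v : Fin t) (x : Fin n → Fin b) (a : ℕ) : ℕ :=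
  if a = 0 then v.val else if h : a - 1 < n then t / 4 + (n - a) * b + (x ⟨a - 1, h⟩).val else 0

theorem blockPos_lt_half {n b : ℕ} (v : Fin t) (x : Fin n → Fin b) (hnb : n * b ≤ t / 2 - t / 4)
    {a : ℕ} (ha0 : a ≠ 0) (ha : a < n + 1) : blockPos t n b v x a < t / 2 := by
  rw [blockPos, if_neg ha0, dif_pos (by omega)]
  have h1 := (x ⟨a - 1, by omega⟩).2
  have h2 : (n - a + 1) * b ≤ n * b := Nat.mul_le_mul_right _ (by omega)
  rw [add_mul, one_mul] at h2
  omega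

theorem blockPos_lt {n b : ℕ} (v : Fin t) (x : Fin n → Fin b) (hnb : n * b ≤ t / 2 - t / 4)
    (a : ℕ) : blockPos t n b v x a < t := by
  by_cases ha0 : a = 0
  · rw [blockPos, if_pos ha0]; exact v.2
  by_cases ha : a < n + 1
  · exact (blockPos_lt_half v x hnb ha0 ha).trans_le (by omega)
  · rw [blockPos, if_neg ha0, dif_neg (by omega)]; exact v.pos

theorem isTreePlacement_blockPos {b : ℕ} {v : Fin t} (hv : t / 2 ≤ v.val)
    (x : Fin (m * treeSize m k) → Fin b) (hnb : m * treeSize m k * b ≤ t / 2 - t / 4) :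
    IsTreePlacement t m k (fun a => ⟨blockPos t _ b v x a, blockPos_lt v x hnb a⟩) where
  anti := by
    intro a a' haa' ha'
    rw [treeSize_succ] at ha'
    rw [Fin.mk_lt_mk]
    by_cases ha0 : a = 0
    · refine (blockPos_lt_half v x hnb (by omega) ha').trans_le ?_
      rw [blockPos, if_pos ha0]; exact hv
    · rw [blockPos, if_neg (by omega), dif_pos (by omega), blockPos, if_neg ha0,
        dif_pos (by omega)]
      have h1 := (x ⟨a' - 1, by omega⟩).2
      have h2 : (m * treeSize m k - a' + 1) * b ≤ (m * treeSize m k - a) * b :=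
        Nat.mul_le_mul_right _ (by omega)
      rw [add_mul, one_mul] at h2
      omega
  root := by simpa [blockPos] using hv
  lower := by
    intro a ha0 ha
    rw [treeSize_succ] at ha
    simp only
    rw [blockPos, if_neg ha0, dif_pos (by omega)]
    omega
  upper := by
    intro a ha0 ha
    rw [treeSize_succ] at ha
    exact blockPos_lt_half v x hnb ha0 ha

theorem blockPos_injective {n b : ℕ} {v : Fin t} {x x' : Fin n → Fin b}
    (h : ∀ a < n + 1, blockPos t n b v x a = blockPos t n b v x' a) : x = x' := by
  funext i
  have h1 := h (i.val + 1) (by have := i.2; omega)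
  rw [blockPos, blockPos, if_neg (by omega), if_neg (by omega), dif_pos (by simp),
    dif_pos (by simp)] at h1
  exact Fin.ext (by simpa using h1)

theorem sum_ite_le_paMk {b : ℕ} (hm : 0 < m) (hnb : m * treeSize m k * b ≤ t / 2 - t / 4)
    (ξ : PAConfig t m) :
    ∑ v ∈ univ.filter (fun v : Fin t => t / 2 ≤ v.val),
      ∑ x : Fin (m * treeSize m k) → Fin b,
        (if ∀ s j, TreeEdge m k (fun a => ⟨blockPos t _ b v x a, blockPos_lt v x hnb a⟩) s j (ξ s j)
          then (1 : ℝ) else 0) ≤ paMk ξ k := by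
  have hM : (paMk ξ k : ℝ) = ∑ v : Fin t, if paMinConn ξ v k then (1 : ℝ) else 0 := by
    rw [paMk, Finset.sum_boole]
  rw [hM]
  refine le_trans ?_ (Finset.sum_le_sum_of_subset_of_nonneg (Finset.subset_univ
    (univ.filter (fun v : Fin t => t / 2 ≤ v.val))) fun v _ _ => by split_ifs <;> norm_num)
  refine Finset.sum_le_sum fun v hv => ?_
  rw [Finset.mem_filter] at hv
  rw [Finset.sum_boole]
  split_ifs with h
  · rw [Nat.cast_le_one, Finset.card_le_one]
    intro x hx x' hx'
    rw [Finset.mem_filter] at hx hx'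
    refine blockPos_injective (t := t) (v := v) fun a ha => ?_
    have := treePlacement_unique hm (by simp [blockPos]) hx.2 hx'.2 a (by rwa [treeSize_succ])
    simpa using this
  · rw [Finset.filter_eq_empty_iff.2]
    · simp
    · intro x _ hx
      refine h ?_
      have := (isTreePlacement_blockPos hv.2 x hnb).paMinConn hm hx
      simpa [blockPos] using this

theorem card_filter_half (t : ℕ) :
    (univ.filter (fun v : Fin t => t / 2 ≤ v.val)).card = t - t / 2 := by
  have h := Finset.card_filter_add_card_filter_not (s := (univ : Finset (Fin t)))
    (fun v => v.val < t / 2)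
  rw [Fin.card_filter_val_lt, Finset.card_univ, Fintype.card_fin] at h
  simp only [not_lt] at h
  omega

/-- Non-asymptotic lower bound for the expected number of minimally-`k`-connected vertices. -/
theorem le_paExp_paMk {δ : ℝ} {b : ℕ} (hm : 2 ≤ m) (hδ₁ : -(m : ℝ) < δ) (hδ₂ : δ < 0)
    (ht : 2 * treeSize m (k + 1) ≤ t / 4) (hnb : m * treeSize m k * b ≤ t / 2 - t / 4) :
    (t - t / 2 : ℕ) * ((b : ℝ) ^ (m * treeSize m k) *
      (((m + δ) / (2 * m * t)) ^ (m * treeSize m k) *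
        (1 - treeSize m (k + 1) * (2 / (t / 4 : ℕ)) : ℝ) ^ (m * t))) ≤
      paExp t m δ (fun ξ => (paMk ξ k : ℝ)) := by
  calc _ = ∑ v ∈ univ.filter (fun v : Fin t => t / 2 ≤ v.val),
        ∑ x : Fin (m * treeSize m k) → Fin b, (((m + δ) / (2 * m * t)) ^ (m * treeSize m k) *
          (1 - treeSize m (k + 1) * (2 / (t / 4 : ℕ)) : ℝ) ^ (m * t)) := by
        rw [Finset.sum_const, card_filter_half, Finset.sum_const, Finset.card_univ]
        simp
    _ ≤ ∑ v ∈ univ.filter (fun v : Fin t => t / 2 ≤ v.val),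
        ∑ x : Fin (m * treeSize m k) → Fin b, paProb t m δ (fun ξ => ∀ s j,
          TreeEdge m k (fun a => ⟨blockPos t _ b v x a, blockPos_lt v x hnb a⟩) s j (ξ s j)) := by
        refine Finset.sum_le_sum fun v hv => Finset.sum_le_sum fun x _ => ?_
        rw [Finset.mem_filter] at hv
        have he := isTreePlacement_blockPos hv.2 x hnb
        exact (he.pow_le_prod_bound hm ht hδ₁).trans (he.prod_bound_le hm hδ₁ hδ₂ ht)
    _ = ∑ ξ, paWeight t m δ ξ * ∑ v ∈ univ.filter (fun v : Fin t => t / 2 ≤ v.val),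
        ∑ x : Fin (m * treeSize m k) → Fin b,
          (if ∀ s j, TreeEdge m k (fun a => ⟨blockPos t _ b v x a, blockPos_lt v x hnb a⟩) s j
            (ξ s j) then (1 : ℝ) else 0) := by
        symm
        simp_rw [Finset.mul_sum]
        rw [Finset.sum_comm]
        refine Finset.sum_congr rfl fun v _ => ?_
        rw [Finset.sum_comm]
        refine Finset.sum_congr rfl fun x _ => ?_
        rw [paProb, Finset.sum_filter]
        refine Finset.sum_congr rfl fun ξ _ => ?_
        split_ifs <;> simp
    _ ≤ _ := by
        exact Finset.sum_le_sum fun ξ _ => mul_le_mul_of_nonneg_left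
          (sum_ite_le_paMk (by omega) hnb ξ) (paWeight_nonneg hm hδ₁ ξ)

end MinConn

section Asymptotics

theorem treeSize_succ_le {m : ℕ} (hm : 2 ≤ m) (k : ℕ) : treeSize m (k + 1) ≤ 2 * m ^ k := by
  have h := Nat.geomSum_lt hm (s := Finset.range k) (n := k) fun i hi => Finset.mem_range.1 hi
  rw [treeSize, Finset.sum_range_succ]
  omega

theorem div_two_mul_le_natCast_div (a b : ℕ) (hb : 0 < b) (hab : b ≤ a) :
    (a : ℝ) / (2 * b) ≤ (a / b : ℕ) := by
  have hb' : (0 : ℝ) < b := by exact_mod_cast hb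
  have h1 : 1 ≤ a / b := (Nat.one_le_div_iff hb).2 hab
  have h2 : a ≤ 2 * b * (a / b) := by
    have h3 := Nat.div_add_mod a b
    have h4 := Nat.mod_lt a hb
    have h5 : b * 1 ≤ b * (a / b) := Nat.mul_le_mul_left _ h1
    rw [mul_assoc, two_mul]
    omega
  rw [div_le_iff₀ (by positivity), mul_comm]
  exact_mod_cast h2

theorem exp_neg_two_mul_le {x : ℝ} (hx0 : 0 ≤ x) (hx : x ≤ 1 / 2) :
    Real.exp (-(2 * x)) ≤ 1 - x := by
  have h1 : 1 + 2 * x ≤ Real.exp (2 * x) := by linarith [Real.add_one_le_exp (2 * x)]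
  rw [Real.exp_neg]
  refine (inv_anti₀ (by linarith) h1).trans ?_
  rw [inv_le_iff_one_le_mul₀ (by linarith)]
  nlinarith

/-- Lower bound for the expected number of minimally-`k`-connected vertices in terms of the size of
the tree. -/
theorem exp_le_paExp_paMk {t m k : ℕ} {δ : ℝ} (hm : 2 ≤ m) (hδ₁ : -(m : ℝ) < δ) (hδ₂ : δ < 0)
    (ht : 4 * treeSize m (k + 1) ≤ t / 4) :
    1 / 2 * Real.exp (Real.log t - treeSize m (k + 1) *
      (Real.log (treeSize m (k + 1)) + (32 * m - Real.log ((m + δ) / (32 * m))))) ≤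
      paExp t m δ (fun ξ => (paMk ξ k : ℝ)) := by
  set N := treeSize m (k + 1) with hNdef
  set n := m * treeSize m k with hn
  have hNn : N = n + 1 := treeSize_succ m k
  have hm' : (2 : ℝ) ≤ m := by exact_mod_cast hm
  have hNpos : (1 : ℝ) ≤ N := by exact_mod_cast (by omega : 1 ≤ N)
  have hq : 0 < t / 4 := by omega
  have hq' : (0 : ℝ) < (t / 4 : ℕ) := by exact_mod_cast hq
  have htpos : (0 : ℝ) < t := by exact_mod_cast (by omega : 0 < t)
  have hqt : (t : ℝ) / 8 ≤ (t / 4 : ℕ) := by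
    have := div_two_mul_le_natCast_div t 4 (by norm_num) (by omega)
    norm_num at this ⊢
    exact this
  set b := t / 4 / N with hb
  have hnb : n * b ≤ t / 2 - t / 4 := by
    have h1 : N * b ≤ t / 4 := Nat.mul_div_le _ _
    have h2 : n * b ≤ N * b := Nat.mul_le_mul_right _ (by omega)
    omega
  have hbt : (t : ℝ) / (16 * N) ≤ b := by
    refine le_trans ?_ (div_two_mul_le_natCast_div (t / 4) N (by omega) (by omega))
    rw [div_le_div_iff₀ (by positivity) (by positivity)]
    nlinarith
  refine le_trans ?_ (le_paExp_paMk hm hδ₁ hδ₂ (by omega) hnb)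
  set κ : ℝ := (m + δ) / (32 * m) with hκ
  have hmδ : 0 < m + δ := by linarith
  have hκ0 : 0 < κ := div_pos hmδ (by positivity)
  have hκ1 : κ ≤ 1 := by rw [hκ, div_le_one (by positivity)]; linarith
  have hA : (1 / 2 * t : ℝ) ≤ (t - t / 2 : ℕ) := by
    have : t ≤ 2 * (t - t / 2) := by omega
    have h2 : (t : ℝ) ≤ 2 * (t - t / 2 : ℕ) := by exact_mod_cast this
    linarith
  have hB : (κ / N) ^ N ≤ (b : ℝ) ^ n * ((m + δ) / (2 * m * t)) ^ n := by
    rw [← mul_pow]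
    calc (κ / N) ^ N ≤ (κ / N) ^ n :=
          pow_le_pow_of_le_one (by positivity)
            (by rw [div_le_one (by positivity)]; linarith) (by omega)
      _ ≤ _ := by
          refine pow_le_pow_left₀ (by positivity) ?_ n
          have h1 : (t : ℝ) / (16 * N) * ((m + δ) / (2 * m * t)) ≤
              b * ((m + δ) / (2 * m * t)) :=
            mul_le_mul_of_nonneg_right hbt (by positivity)
          refine le_trans (le_of_eq ?_) h1
          rw [hκ]
          field_simp
          ring
  have hC : Real.exp (-(32 * m * N)) ≤ (1 - N * (2 / (t / 4 : ℕ)) : ℝ) ^ (m * t) := by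
    have hx : (N * (2 / (t / 4 : ℕ)) : ℝ) ≤ 1 / 2 := by
      have h4 : (4 * N : ℝ) ≤ (t / 4 : ℕ) := by exact_mod_cast ht
      rw [mul_div_assoc', div_le_iff₀ hq']
      linarith
    have h1 := exp_neg_two_mul_le (x := N * (2 / (t / 4 : ℕ))) (by positivity) hx
    refine le_trans ?_ (pow_le_pow_left₀ (Real.exp_nonneg _) h1 (m * t))
    rw [← Real.exp_nat_mul]
    refine Real.exp_le_exp.2 ?_
    have h2 : (t : ℝ) / (t / 4 : ℕ) ≤ 8 := by
      rw [div_le_iff₀ hq']; linarith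
    have h3 : ((m * t : ℕ) : ℝ) * -(2 * (N * (2 / (t / 4 : ℕ)))) =
        -(4 * m * N * (t / (t / 4 : ℕ))) := by push_cast; ring
    rw [h3]
    have h4 : (4 * m * N : ℝ) * (t / (t / 4 : ℕ)) ≤ 4 * m * N * 8 :=
      mul_le_mul_of_nonneg_left h2 (by positivity)
    linarith
  have hE : Real.exp (Real.log t - N * (Real.log N + (32 * m - Real.log κ))) =
      t * ((κ / N) ^ N * Real.exp (-(32 * m * N))) := by
    have h1 : Real.log t - N * (Real.log N + (32 * m - Real.log κ)) =
        Real.log t + (N * Real.log (κ / N) + -(32 * m * N)) := by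
      rw [Real.log_div hκ0.ne' (by positivity)]; ring
    rw [h1, Real.exp_add, Real.exp_add, Real.exp_log htpos, Real.exp_nat_mul,
      Real.exp_log (by positivity)]
  rw [hE, ← mul_assoc, ← mul_assoc ((b : ℝ) ^ n)]
  have hB' : 0 ≤ (κ / N) ^ N := by positivity
  exact mul_le_mul hA (mul_le_mul hB hC (Real.exp_nonneg _) (hB'.trans hB)) (by positivity)
    (by positivity)

theorem treeSize_ktMinus_le {m t : ℕ} (hm : 2 ≤ m) {ε ε' : ℝ} (hε : ε' ≤ ε) (hε' : ε' ≤ 1)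
    (ht : 1 ≤ Real.log t) :
    (treeSize m (ktMinus ε m t + 1) : ℝ) ≤ 2 * m * Real.log t ^ (1 - ε') := by
  have hm' : (1 : ℝ) < m := by exact_mod_cast hm
  have hlm : 0 < Real.log m := Real.log_pos hm'
  have hll : 0 ≤ Real.log (Real.log t) := Real.log_nonneg ht
  have hk : (ktMinus ε m t : ℝ) ≤ (1 - ε') * Real.log (Real.log t) / Real.log m + 1 := by
    set y := (1 - ε) * Real.log (Real.log t) / Real.log m with hy
    have hyy : y ≤ (1 - ε') * Real.log (Real.log t) / Real.log m := by
      rw [hy]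
      exact div_le_div_of_nonneg_right (mul_le_mul_of_nonneg_right (by linarith) hll) hlm.le
    have h0 : 0 ≤ (1 - ε') * Real.log (Real.log t) / Real.log m :=
      div_nonneg (mul_nonneg (by linarith) hll) hlm.le
    have hr : (round y : ℝ) ≤ y + 1 := by
      have := abs_le.1 (abs_sub_round y)
      linarith
    have hcast : (ktMinus ε m t : ℝ) = max (round y : ℝ) 0 := by
      have h : ((round y).toNat : ℤ) = max (round y) 0 := Int.toNat_eq_max _
      have h2 : (((round y).toNat : ℤ) : ℝ) = ((max (round y) 0 : ℤ) : ℝ) := by rw [h]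
      rw [Int.cast_max, Int.cast_zero, Int.cast_natCast] at h2
      exact h2
    rw [hcast]
    exact max_le (by linarith) (by linarith)
  have hpow : (m : ℝ) ^ ktMinus ε m t ≤ m * Real.log t ^ (1 - ε') := by
    have h1 : (m : ℝ) ^ ktMinus ε m t = Real.exp (ktMinus ε m t * Real.log m) := by
      rw [Real.exp_nat_mul, Real.exp_log (by linarith)]
    have h2 : (m : ℝ) * Real.log t ^ (1 - ε') =
        Real.exp (((1 - ε') * Real.log (Real.log t) / Real.log m + 1) * Real.log m) := by
      rw [add_mul, one_mul, div_mul_cancel₀ _ hlm.ne', Real.exp_add, Real.exp_log (by linarith),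
        Real.rpow_def_of_pos (by linarith)]
      ring_nf
    rw [h1, h2]
    exact Real.exp_le_exp.2 (mul_le_mul_of_nonneg_right hk hlm.le)
  have h3 : (treeSize m (ktMinus ε m t + 1) : ℝ) ≤ 2 * (m : ℝ) ^ ktMinus ε m t := by
    exact_mod_cast treeSize_succ_le hm _
  linarith

theorem mul_log_add_le {x η C : ℝ} (hx : 1 ≤ x) (hη : 0 < η) (hC : 0 ≤ C) :
    x * (Real.log x + C) ≤ (1 / η + C) * x ^ (1 + η) := by
  have hx0 : 0 < x := by linarith
  have h1 : Real.log x ≤ x ^ η / η := Real.log_le_rpow_div hx0.le hη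
  have h2 : 1 ≤ x ^ η := Real.one_le_rpow hx hη.le
  rw [Real.rpow_add hx0, Real.rpow_one]
  calc x * (Real.log x + C) ≤ x * (x ^ η / η + C * x ^ η) :=
        mul_le_mul_of_nonneg_left (add_le_add h1 (le_mul_of_one_le_right hC h2)) hx0.le
    _ = _ := by ring

theorem tendsto_sub_mul_rpow {C a : ℝ} (ha : a < 1) :
    Tendsto (fun x : ℝ => x - C * x ^ a) atTop atTop := by
  have h1 : Tendsto (fun x : ℝ => 1 - C * x ^ (-(1 - a))) atTop (nhds (1 - C * 0)) :=
    ((tendsto_rpow_neg_atTop (by linarith : 0 < 1 - a)).const_mul C).const_sub 1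
  rw [mul_zero, sub_zero] at h1
  refine (tendsto_id.atTop_mul_pos one_pos h1).congr' ?_
  filter_upwards [eventually_gt_atTop 0] with x hx
  have h2 : x ^ a = x * x ^ (-(1 - a)) := by
    nth_rewrite 2 [← Real.rpow_one x]
    rw [← Real.rpow_add hx]
    congr 1; ring
  rw [h2, id]; ring

theorem eventually_treeSize_le {m : ℕ} (hm : 2 ≤ m) {ε : ℝ} (hε : 0 < ε) :
    ∀ᶠ t : ℕ in atTop, 4 * treeSize m (ktMinus ε m t + 1) ≤ t / 4 := by
  have hlog : Tendsto (fun t : ℕ => Real.log t) atTop atTop :=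
    Real.tendsto_log_atTop.comp tendsto_natCast_atTop_atTop
  have hm0 : (0 : ℝ) < m := by positivity
  have ho := (Real.isLittleO_log_id_atTop.comp_tendsto tendsto_natCast_atTop_atTop).def
    (c := 1 / (32 * m)) (by positivity)
  filter_upwards [ho, hlog.eventually_ge_atTop 1] with t ht hl
  have h1 := treeSize_ktMinus_le hm (min_le_left ε (1 / 2)) (by linarith [min_le_right ε (1 / 2)])
    hl
  have h2 : Real.log t ^ (1 - min ε (1 / 2)) ≤ Real.log t := by
    conv_rhs => rw [← Real.rpow_one (Real.log t)]
    exact Real.rpow_le_rpow_of_exponent_le hl (by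
      have : 0 < min ε (1 / 2) := lt_min hε (by norm_num)
      linarith)
  simp only [Function.comp, id, Real.norm_eq_abs] at ht
  rw [abs_of_nonneg (by linarith), abs_of_nonneg (by positivity)] at ht
  have h3 : (2 * m : ℝ) * Real.log t ^ (1 - min ε (1 / 2)) ≤ 2 * m * (1 / (32 * m) * t) :=
    mul_le_mul_of_nonneg_left (h2.trans ht) (by positivity)
  have h4 : (2 * m : ℝ) * (1 / (32 * m) * t) = t / 16 := by field_simp; ring
  have h5 : (16 * treeSize m (ktMinus ε m t + 1) : ℝ) ≤ t := by linarith
  have h6 : 16 * treeSize m (ktMinus ε m t + 1) ≤ t := by exact_mod_cast h5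
  omega

end Asymptotics

/-- **First moment of the number of minimally connected vertices (Proposition 4.7).**
For `m ≥ 2` and `δ ∈ (-m, 0)`, with `k_t^- = (1-ε) log log t / log m`,
`E[M_{k_t^-}] → ∞` as `t → ∞`. -/
theorem pa_Mk_first_moment (m : ℕ) (hm : 2 ≤ m) (δ : ℝ) (hδ₁ : -(m : ℝ) < δ)
    (hδ₂ : δ < 0) (ε : ℝ) (hε : 0 < ε) :
    Tendsto (fun t : ℕ => paExp t m δ (fun ξ => (paMk ξ (ktMinus ε m t) : ℝ)))
      atTop atTop := by
  set η : ℝ := min ε (1 / 2) with hη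
  have hη0 : 0 < η := lt_min hε (by norm_num)
  have hη1 : η ≤ 1 / 2 := min_le_right _ _
  have hm' : (2 : ℝ) ≤ m := by exact_mod_cast hm
  set C : ℝ := 32 * m - Real.log ((m + δ) / (32 * m)) with hC
  have hC0 : 0 ≤ C := by
    have : Real.log ((m + δ) / (32 * m)) ≤ 0 :=
      Real.log_nonpos (div_nonneg (by linarith) (by positivity))
        (by rw [div_le_one (by positivity)]; linarith)
    linarith
  have hlog : Tendsto (fun t : ℕ => Real.log t) atTop atTop :=
    Real.tendsto_log_atTop.comp tendsto_natCast_atTop_atTop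
  have hexp : Tendsto (fun t : ℕ => 1 / 2 * Real.exp (Real.log t -
      ((1 / η + C) * (2 * m) ^ (1 + η)) * Real.log t ^ ((1 - η) * (1 + η)))) atTop atTop :=
    ((Real.tendsto_exp_atTop.comp
      (tendsto_sub_mul_rpow (by nlinarith))).comp hlog).const_mul_atTop (by norm_num)
  refine tendsto_atTop_mono' _ ?_ hexp
  filter_upwards [eventually_treeSize_le hm hε, hlog.eventually_ge_atTop 1] with t ht hl
  refine le_trans ?_ (exp_le_paExp_paMk hm hδ₁ hδ₂ ht)
  refine mul_le_mul_of_nonneg_left (Real.exp_le_exp.2 (sub_le_sub_left ?_ _)) (by norm_num)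
  have hN := treeSize_ktMinus_le hm (min_le_left ε (1 / 2)) (by linarith : η ≤ 1) hl
  have hN1 : (1 : ℝ) ≤ treeSize m (ktMinus ε m t + 1) := by
    rw [treeSize_succ]; push_cast
    have : (0 : ℝ) ≤ m * treeSize m (ktMinus ε m t) := by positivity
    linarith
  refine (mul_log_add_le hN1 hη0 hC0).trans ?_
  rw [mul_assoc (1 / η + C), Real.rpow_mul (by linarith), ← Real.mul_rpow (by positivity)
    (by positivity)]
  exact mul_le_mul_of_nonneg_left (Real.rpow_le_rpow (by linarith) hN (by linarith))
    (by positivity)
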